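/- Let Ω ⊂ ℝⁿ be a bounded domain such that (Ω, k_Ω) is Gromov hyperbolic. If (Ω, d_Euc) is a quasi-convex metric space, then Ω is a QH-visibility domain which has no geodesic loop in the Euclidean closure Ω̄^Euc. -/

import Mathlib

open Metric Set Filter Topology MeasureTheory
open scoped NNReal ENNReal

noncomputable section

variable {E : Type*} [NormedAddCommGroup E] [NormedSpace ℝ E]

/-- The quasihyperbolic length of a path `γ : [a, b] → Ω`, i.e. `∫ ‖γ'(t)‖ / δ_Ω(γ t) dt`. -/
def qhLength (Ω : Set E) (γ : ℝ → E) (a b : ℝ) : ℝ :=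
  ∫ t in a..b, ‖deriv γ t‖ / infDist (γ t) Ωᶜ

/-- Admissible (Lipschitz, i.e. rectifiable) paths joining `x` to `y` inside `Ω`. -/
def qhAdmissible (Ω : Set E) (x y : E) (γ : ℝ → E) (a b : ℝ) : Prop :=
  a ≤ b ∧ γ a = x ∧ γ b = y ∧ (∀ t ∈ Icc a b, γ t ∈ Ω) ∧
    ∃ K : ℝ≥0, LipschitzOnWith K γ (Icc a b)

/-- The quasihyperbolic distance `k_Ω` on a domain `Ω`. -/
def qhDist (Ω : Set E) (x y : E) : ℝ :=
  sInf { L : ℝ | ∃ γ a b, qhAdmissible Ω x y γ a b ∧ L = qhLength Ω γ a b }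

/-- `γ` is a (unit-speed) quasihyperbolic geodesic on the parameter set `s`. -/
def IsQHGeodesicOn (Ω : Set E) (γ : ℝ → E) (s : Set ℝ) : Prop :=
  (∀ t ∈ s, γ t ∈ Ω) ∧ ∀ a ∈ s, ∀ b ∈ s, qhDist Ω (γ a) (γ b) = |a - b|

/-- `Ω` is a QH-visibility domain: any two distinct Euclidean boundary points have
neighbourhoods with disjoint closures together with a compact subset of `Ω` which is met by
every quasihyperbolic geodesic joining the two neighbourhoods. -/
def QHVisibilityDomain (Ω : Set E) : Prop :=
  ∀ p ∈ frontier Ω, ∀ q ∈ frontier Ω, p ≠ q →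
    ∃ U V : Set E, IsOpen U ∧ IsOpen V ∧ p ∈ U ∧ q ∈ V ∧
      closure U ∩ closure V = ∅ ∧
      ∃ K : Set E, IsCompact K ∧ K ⊆ Ω ∧
        ∀ (γ : ℝ → E) (T : ℝ), 0 ≤ T → IsQHGeodesicOn Ω γ (Icc 0 T) →
          γ 0 ∈ U → γ T ∈ V → ∃ t ∈ Icc 0 T, γ t ∈ K

/-- The Gromov product with respect to the quasihyperbolic distance. -/
def qhGromovProd (Ω : Set E) (o x y : E) : ℝ :=
  (qhDist Ω x o + qhDist Ω o y - qhDist Ω x y) / 2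

/-- `(Ω, k_Ω)` is Gromov hyperbolic (four-point condition on the Gromov product). -/
def QHGromovHyperbolic (Ω : Set E) : Prop :=
  ∃ δ : ℝ, 0 ≤ δ ∧ ∀ o ∈ Ω, ∀ x ∈ Ω, ∀ y ∈ Ω, ∀ z ∈ Ω,
    min (qhGromovProd Ω o x y) (qhGromovProd Ω o y z) - δ ≤ qhGromovProd Ω o x z

/-- A quasihyperbolic geodesic line. -/
def IsQHGeodesicLine (Ω : Set E) (γ : ℝ → E) : Prop :=
  IsQHGeodesicOn Ω γ univ

/-- `Ω` has no geodesic loop in its Euclidean closure: no quasihyperbolic geodesic line has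
equal cluster sets at `+∞` and `-∞`. -/
def NoGeodesicLoop (Ω : Set E) : Prop :=
  ∀ γ : ℝ → E, IsQHGeodesicLine Ω γ →
    {x : E | MapClusterPt x atTop γ} ≠ {x : E | MapClusterPt x atBot γ}

/-- `(s, d_Euc)` is quasi-convex: some `A ≥ 1` allows joining any two points of `s` by a
curve in `s` of length at most `A` times their distance. -/
def IsQuasiconvexSet (s : Set E) : Prop :=
  ∃ A : ℝ, 1 ≤ A ∧ ∀ x ∈ s, ∀ y ∈ s, ∃ (γ : ℝ → E) (a b : ℝ), a ≤ b ∧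
    ContinuousOn γ (Icc a b) ∧ γ a = x ∧ γ b = y ∧ (∀ t ∈ Icc a b, γ t ∈ s) ∧
    eVariationOn γ (Icc a b) ≤ ENNReal.ofReal (A * dist x y)

set_option linter.unusedSectionVars false

section QuasihyperbolicLength

variable [CompleteSpace E] {Ω : Set E} {x y z : E} {γ : ℝ → E} {a b : ℝ}

lemma infDist_compl_pos (hO : IsOpen Ω) (hne : Ωᶜ.Nonempty) (hx : x ∈ Ω) :
    0 < infDist x Ωᶜ :=
  (hO.isClosed_compl.notMem_iff_infDist_pos hne).1 (by simpa using hx)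

lemma qhLength_nonneg (Ω : Set E) (γ : ℝ → E) (hab : a ≤ b) : 0 ≤ qhLength Ω γ a b :=
  intervalIntegral.integral_nonneg hab fun _ _ => div_nonneg (norm_nonneg _) infDist_nonneg

lemma intervalIntegrable_norm_deriv {K : ℝ≥0} (hab : a ≤ b)
    (h : LipschitzOnWith K γ (Icc a b)) :
    IntervalIntegrable (fun t => ‖deriv γ t‖) volume a b := by
  rw [intervalIntegrable_iff_integrableOn_Ioo_of_le hab]
  refine Measure.integrableOn_of_bounded (M := K) (by simp)
    (stronglyMeasurable_deriv γ).norm.aestronglyMeasurable ?_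
  refine (ae_restrict_iff' measurableSet_Ioo).2 (Eventually.of_forall fun t ht => ?_)
  simpa using norm_deriv_le_of_lipschitzOn (Icc_mem_nhds ht.1 ht.2) h

lemma intervalIntegrable_qh (hO : IsOpen Ω) (hne : Ωᶜ.Nonempty)
    (h : qhAdmissible Ω x y γ a b) :
    IntervalIntegrable (fun t => ‖deriv γ t‖ / infDist (γ t) Ωᶜ) volume a b := by
  obtain ⟨hab, -, -, hmem, K, hK⟩ := h
  simp only [div_eq_mul_inv]
  refine (intervalIntegrable_norm_deriv hab hK).mul_continuousOn ?_
  rw [uIcc_of_le hab]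
  exact ((continuous_infDist_pt _).comp_continuousOn hK.continuousOn).inv₀
    fun t ht => (infDist_compl_pos hO hne (hmem t ht)).ne'

lemma qhAdmissible.mono (h : qhAdmissible Ω x y γ a b) {c d : ℝ} (hc : a ≤ c) (hcd : c ≤ d)
    (hd : d ≤ b) : qhAdmissible Ω (γ c) (γ d) γ c d :=
  ⟨hcd, rfl, rfl, fun t ht => h.2.2.2.1 t (Icc_subset_Icc hc hd ht),
    h.2.2.2.2.imp fun _ hK => hK.mono (Icc_subset_Icc hc hd)⟩

lemma qhDist_le_qhLength (h : qhAdmissible Ω x y γ a b) : qhDist Ω x y ≤ qhLength Ω γ a b := by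
  refine csInf_le ⟨0, ?_⟩ ⟨γ, a, b, h, rfl⟩
  rintro L ⟨γ, a, b, h, rfl⟩
  exact qhLength_nonneg Ω γ h.1

lemma qhDist_nonneg (Ω : Set E) (x y : E) : 0 ≤ qhDist Ω x y := by
  refine Real.sInf_nonneg ?_
  rintro L ⟨γ, a, b, h, rfl⟩
  exact qhLength_nonneg Ω γ h.1

lemma qhAdmissible.reverse (h : qhAdmissible Ω x y γ a b) :
    qhAdmissible Ω y x (fun t => γ (a + b - t)) a b := by
  obtain ⟨hab, ha, hb, hmem, K, hK⟩ := h
  have hmaps : ∀ t ∈ Icc a b, a + b - t ∈ Icc a b := fun t ht =>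
    ⟨by linarith [ht.2], by linarith [ht.1]⟩
  refine ⟨hab, by simpa, by simpa, fun t ht => hmem _ (hmaps t ht), K, ?_⟩
  refine LipschitzOnWith.of_dist_le_mul fun s hs t ht => ?_
  refine (hK.dist_le_mul _ (hmaps s hs) _ (hmaps t ht)).trans_eq ?_
  rw [dist_sub_left]

lemma qhLength_reverse (Ω : Set E) (γ : ℝ → E) (a b : ℝ) :
    qhLength Ω (fun t => γ (a + b - t)) a b = qhLength Ω γ a b := by
  unfold qhLength
  simp only [deriv_comp_const_sub, norm_neg]
  rw [intervalIntegral.integral_comp_sub_left (fun t => ‖deriv γ t‖ / infDist (γ t) Ωᶜ)]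
  simp

lemma qhDist_comm (Ω : Set E) (x y : E) : qhDist Ω x y = qhDist Ω y x := by
  have key : ∀ x y : E, {L : ℝ | ∃ γ a b, qhAdmissible Ω x y γ a b ∧ L = qhLength Ω γ a b} ⊆
      {L : ℝ | ∃ γ a b, qhAdmissible Ω y x γ a b ∧ L = qhLength Ω γ a b} := by
    rintro x y L ⟨γ, a, b, h, rfl⟩
    exact ⟨_, a, b, h.reverse, (qhLength_reverse Ω γ a b).symm⟩
  unfold qhDist
  rw [(key x y).antisymm (key y x)]

lemma qhAdmissible.trans (hO : IsOpen Ω) (hne : Ωᶜ.Nonempty) {γ' : ℝ → E} {c d : ℝ}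
    (h : qhAdmissible Ω x y γ a b) (h' : qhAdmissible Ω y z γ' c d) :
    ∃ σ : ℝ → E, qhAdmissible Ω x z σ a (b + (d - c)) ∧
      qhLength Ω σ a (b + (d - c)) = qhLength Ω γ a b + qhLength Ω γ' c d := by
  obtain ⟨hab, ha, hb, hmem, K, hK⟩ := id h
  obtain ⟨hcd, hc, hd, hmem', K', hK'⟩ := id h'
  set σ : ℝ → E := fun t => if t ≤ b then γ t else γ' (t + (c - b)) with hσ
  have hσ1 : ∀ t ≤ b, σ t = γ t := fun t ht => by simp [hσ, ht]
  have hσ2 : ∀ t, b ≤ t → σ t = γ' (t + (c - b)) := by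
    intro t ht
    rcases ht.eq_or_lt with rfl | ht
    · simp [hσ, hb, hc]
    · simp [hσ, ht.not_ge]
  have hadm : qhAdmissible Ω x z σ a (b + (d - c)) := by
    refine ⟨by linarith, by rw [hσ1 a hab, ha], ?_, fun t ht => ?_, max K K', ?_⟩
    · rw [hσ2 _ (by linarith), ← hd]
      congr 1
      ring
    · rcases le_total t b with htb | htb
      · rw [hσ1 t htb]
        exact hmem t ⟨ht.1, htb⟩
      · rw [hσ2 t htb]
        exact hmem' _ ⟨by linarith, by linarith [ht.2]⟩
    · have key : ∀ s ∈ Icc a (b + (d - c)), ∀ t ∈ Icc a (b + (d - c)), s ≤ t →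
          dist (σ s) (σ t) ≤ max (K : ℝ) K' * (t - s) := by
        intro s hs t ht hst
        have e1 : ∀ s ∈ Icc a b, ∀ t ∈ Icc a b, s ≤ t →
            dist (σ s) (σ t) ≤ max (K : ℝ) K' * (t - s) := by
          intro s hs t ht hst
          rw [hσ1 s hs.2, hσ1 t ht.2]
          refine (hK.dist_le_mul s hs t ht).trans ?_
          rw [dist_comm, Real.dist_eq, abs_of_nonneg (sub_nonneg.2 hst)]
          exact mul_le_mul_of_nonneg_right (le_max_left _ _) (sub_nonneg.2 hst)
        have e2 : ∀ s ∈ Icc b (b + (d - c)), ∀ t ∈ Icc b (b + (d - c)), s ≤ t →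
            dist (σ s) (σ t) ≤ max (K : ℝ) K' * (t - s) := by
          intro s hs t ht hst
          rw [hσ2 s hs.1, hσ2 t ht.1]
          refine (hK'.dist_le_mul _ ⟨by linarith [hs.1], by linarith [hs.2]⟩ _
            ⟨by linarith [ht.1], by linarith [ht.2]⟩).trans ?_
          rw [dist_add_right, dist_comm, Real.dist_eq, abs_of_nonneg (sub_nonneg.2 hst)]
          exact mul_le_mul_of_nonneg_right (le_max_right _ _) (sub_nonneg.2 hst)
        rcases le_total t b with htb | htb
        · exact e1 s ⟨hs.1, hst.trans htb⟩ t ⟨ht.1, htb⟩ hst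
        rcases le_total b s with hbs | hbs
        · exact e2 s ⟨hbs, hs.2⟩ t ⟨htb, ht.2⟩ hst
        · have := e1 s ⟨hs.1, hbs⟩ b ⟨hab, le_rfl⟩ hbs
          have := e2 b ⟨le_rfl, by linarith⟩ t ⟨htb, ht.2⟩ htb
          linarith [dist_triangle (σ s) (σ b) (σ t)]
      refine LipschitzOnWith.of_dist_le_mul fun s hs t ht => ?_
      rw [NNReal.coe_max, Real.dist_eq]
      rcases le_total s t with hst | hst
      · rw [abs_sub_comm, abs_of_nonneg (sub_nonneg.2 hst)]
        exact key s hs t ht hst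
      · rw [abs_of_nonneg (sub_nonneg.2 hst), dist_comm]
        exact key t ht s hs hst
  refine ⟨σ, hadm, ?_⟩
  have hint := intervalIntegrable_qh hO hne hadm
  have hb' : b ≤ b + (d - c) := by linarith
  unfold qhLength
  rw [← intervalIntegral.integral_add_adjacent_intervals (b := b)
    (hint.mono_set (by rw [uIcc_of_le hab, uIcc_of_le (hab.trans hb')];
                       exact Icc_subset_Icc_right hb'))
    (hint.mono_set (by rw [uIcc_of_le hb', uIcc_of_le (hab.trans hb')];
                       exact Icc_subset_Icc_left hab))]
  congr 1
  · refine intervalIntegral.integral_congr_uIoo fun t ht => ?_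
    rw [uIoo_of_le hab] at ht
    have : σ =ᶠ[𝓝 t] γ := by
      filter_upwards [Iio_mem_nhds ht.2] with s hs using hσ1 s (le_of_lt hs)
    simp only [this.deriv_eq, this.eq_of_nhds]
  · have : ∫ t in b..b + (d - c), ‖deriv σ t‖ / infDist (σ t) Ωᶜ =
        ∫ t in b..b + (d - c), ‖deriv γ' (t + (c - b))‖ / infDist (γ' (t + (c - b))) Ωᶜ := by
      refine intervalIntegral.integral_congr_uIoo fun t ht => ?_
      rw [uIoo_of_le hb'] at ht
      have : σ =ᶠ[𝓝 t] fun t => γ' (t + (c - b)) := by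
        filter_upwards [Ioi_mem_nhds ht.1] with s hs using hσ2 s (le_of_lt hs)
      simp only [this.deriv_eq, this.eq_of_nhds, deriv_comp_add_const]
    rw [this, intervalIntegral.integral_comp_add_right
      (fun t => ‖deriv γ' t‖ / infDist (γ' t) Ωᶜ)]
    congr 1 <;> ring

lemma qhAdmissible_segment (hr : dist x y < infDist x Ωᶜ) :
    qhAdmissible Ω x y (fun t : ℝ => x + t • (y - x)) 0 1 := by
  refine ⟨zero_le_one, by simp, by simp, fun t ht => ?_, ‖y - x‖₊, ?_⟩
  · refine ball_infDist_compl_subset (x := x) ?_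
    rw [mem_ball_iff_norm, add_sub_cancel_left, norm_smul, Real.norm_of_nonneg ht.1]
    rw [dist_comm, dist_eq_norm] at hr
    nlinarith [norm_nonneg (y - x), ht.2]
  · refine LipschitzOnWith.of_dist_le_mul fun s _ t _ => ?_
    rw [dist_add_left, dist_eq_norm, ← sub_smul, norm_smul, mul_comm, coe_nnnorm, Real.dist_eq,
      Real.norm_eq_abs]

lemma qhDist_le_of_dist_lt (hO : IsOpen Ω) (hne : Ωᶜ.Nonempty) (hr : dist x y < infDist x Ωᶜ) :
    qhDist Ω x y ≤ dist x y / (infDist x Ωᶜ - dist x y) := by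
  have hadm := qhAdmissible_segment hr
  refine (qhDist_le_qhLength hadm).trans ?_
  have : ∀ t ∈ Icc (0 : ℝ) 1, ‖deriv (fun t : ℝ => x + t • (y - x)) t‖ /
      infDist (x + t • (y - x)) Ωᶜ ≤ dist x y / (infDist x Ωᶜ - dist x y) := by
    intro t ht
    have hd : HasDerivAt (fun t : ℝ => x + t • (y - x)) (y - x) t := by
      simpa using ((hasDerivAt_id t).smul_const (y - x)).const_add x
    rw [hd.deriv, dist_comm x y, dist_eq_norm y x]
    refine div_le_div_of_nonneg_left (norm_nonneg _) ?_ ?_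
    · rw [dist_comm, dist_eq_norm] at hr
      linarith
    · have h1 : infDist x Ωᶜ ≤ infDist (x + t • (y - x)) Ωᶜ + dist x (x + t • (y - x)) :=
        infDist_le_infDist_add_dist
      rw [dist_self_add_right, norm_smul, Real.norm_of_nonneg ht.1] at h1
      nlinarith [norm_nonneg (y - x), ht.2]
  have h2 := intervalIntegral.integral_mono_on zero_le_one (intervalIntegrable_qh hO hne hadm)
    (intervalIntegrable_const (c := dist x y / (infDist x Ωᶜ - dist x y))) this
  simpa [qhLength] using h2

lemma exists_qhAdmissible (hO : IsOpen Ω) (hne : Ωᶜ.Nonempty) (hc : IsPreconnected Ω)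
    (hx : x ∈ Ω) (hy : y ∈ Ω) : ∃ γ a b, qhAdmissible Ω x y γ a b := by
  refine hc.induction₂ (fun x y => ∃ γ a b, qhAdmissible Ω x y γ a b) (fun x hx => ?_) ?_ ?_ hx hy
  · filter_upwards [mem_nhdsWithin_of_mem_nhds
      (ball_mem_nhds x (infDist_compl_pos hO hne hx))] with y hy
    exact ⟨_, _, _, qhAdmissible_segment (by rwa [dist_comm])⟩
  · rintro x y z - - - ⟨γ, a, b, h⟩ ⟨γ', c, d, h'⟩
    obtain ⟨σ, hσ, -⟩ := h.trans hO hne h'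
    exact ⟨σ, _, _, hσ⟩
  · rintro x y - - ⟨γ, a, b, h⟩
    exact ⟨_, _, _, h.reverse⟩

lemma exists_qhLength_lt (hO : IsOpen Ω) (hne : Ωᶜ.Nonempty) (hc : IsPreconnected Ω)
    (hx : x ∈ Ω) (hy : y ∈ Ω) {ε : ℝ} (hε : 0 < ε) :
    ∃ γ a b, qhAdmissible Ω x y γ a b ∧ qhLength Ω γ a b < qhDist Ω x y + ε := by
  obtain ⟨γ, a, b, h⟩ := exists_qhAdmissible hO hne hc hx hy
  obtain ⟨L, ⟨γ, a, b, h, rfl⟩, hL⟩ := exists_lt_of_csInf_lt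
    (s := {L : ℝ | ∃ γ a b, qhAdmissible Ω x y γ a b ∧ L = qhLength Ω γ a b})
    ⟨_, γ, a, b, h, rfl⟩ (lt_add_of_pos_right _ hε)
  exact ⟨γ, a, b, h, hL⟩

lemma qhDist_triangle (hO : IsOpen Ω) (hne : Ωᶜ.Nonempty) (hc : IsPreconnected Ω)
    (hx : x ∈ Ω) (hy : y ∈ Ω) (hz : z ∈ Ω) :
    qhDist Ω x z ≤ qhDist Ω x y + qhDist Ω y z := by
  refine le_of_forall_pos_le_add fun ε hε => ?_
  obtain ⟨γ, a, b, h, hl⟩ := exists_qhLength_lt hO hne hc hx hy (half_pos hε)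
  obtain ⟨γ', c, d, h', hl'⟩ := exists_qhLength_lt hO hne hc hy hz (half_pos hε)
  obtain ⟨σ, hσ, hlσ⟩ := h.trans hO hne h'
  linarith [qhDist_le_qhLength hσ]

lemma qhLength_add (hO : IsOpen Ω) (hne : Ωᶜ.Nonempty) (h : qhAdmissible Ω x y γ a b) {c : ℝ}
    (hc : c ∈ Icc a b) : qhLength Ω γ a b = qhLength Ω γ a c + qhLength Ω γ c b :=
  (intervalIntegral.integral_add_adjacent_intervals
    (intervalIntegrable_qh hO hne (h.mono le_rfl hc.1 hc.2))
    (intervalIntegrable_qh hO hne (h.mono hc.1 hc.2 le_rfl))).symm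

lemma qhDist_self (hO : IsOpen Ω) (hne : Ωᶜ.Nonempty) (hx : x ∈ Ω) : qhDist Ω x x = 0 := by
  refine le_antisymm ?_ (qhDist_nonneg _ _ _)
  simpa using qhDist_le_of_dist_lt hO hne (x := x) (y := x)
    (by simpa using infDist_compl_pos hO hne hx)

end QuasihyperbolicLength

section QuasihyperbolicDistance

variable [CompleteSpace E] [FiniteDimensional ℝ E] {Ω : Set E} {x y z w : E}

lemma abs_deriv_norm_sub_le {γ : ℝ → E} {x : E} {c t : ℝ} (hγ : DifferentiableAt ℝ γ t)
    (hN : DifferentiableAt ℝ (fun s => c + ‖γ s - x‖) t) :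
    |deriv (fun s => c + ‖γ s - x‖) t| ≤ ‖deriv γ t‖ := by
  have h1 := (hasDerivAt_iff_tendsto_slope.1 hN.hasDerivAt).norm
  have h2 := (hasDerivAt_iff_tendsto_slope.1 hγ.hasDerivAt).norm
  refine le_of_tendsto_of_tendsto' h1 h2 fun s => ?_
  rw [slope_def_module, slope_def_module, norm_smul, norm_smul]
  gcongr
  rw [add_sub_add_left_eq_sub]
  refine (abs_norm_sub_norm_le _ _).trans_eq ?_
  congr 1
  abel

lemma log_le_qhLength (hO : IsOpen Ω) (hne : Ωᶜ.Nonempty) {γ : ℝ → E} {a b : ℝ}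
    (h : qhAdmissible Ω x y γ a b) :
    Real.log (infDist x Ωᶜ + ‖y - x‖) - Real.log (infDist x Ωᶜ) ≤ qhLength Ω γ a b := by
  have hint := intervalIntegrable_qh hO hne h
  obtain ⟨hab, ha, hb, hmem, K, hK⟩ := h
  have hx : x ∈ Ω := ha ▸ hmem a ⟨le_rfl, hab⟩
  set d := infDist x Ωᶜ with hd
  have hdpos : 0 < d := infDist_compl_pos hO hne hx
  set N : ℝ → ℝ := fun t => d + ‖γ t - x‖ with hN
  have hdN : ∀ t, d ≤ N t := fun t => le_add_of_nonneg_right (norm_nonneg _)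
  have hNpos : ∀ t, 0 < N t := fun t => hdpos.trans_le (hdN t)
  have hNlip : LipschitzOnWith K N (uIcc a b) := by
    rw [uIcc_of_le hab]
    refine LipschitzOnWith.of_dist_le_mul fun s hs t ht => ?_
    refine le_trans ?_ (hK.dist_le_mul s hs t ht)
    rw [dist_add_left, dist_eq_norm (γ s), Real.dist_eq]
    refine (abs_norm_sub_norm_le _ _).trans_eq ?_
    congr 1
    abel
  have hlog : LipschitzOnWith (Real.toNNReal d⁻¹ * K) (fun t => Real.log (N t)) (uIcc a b) := by
    have hl : LipschitzOnWith (Real.toNNReal d⁻¹) Real.log (Ici d) := by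
      refine (convex_Ici d).lipschitzOnWith_of_nnnorm_deriv_le
        (fun t ht => Real.differentiableAt_log (hdpos.trans_le ht).ne') fun t ht => ?_
      rw [← NNReal.coe_le_coe, coe_nnnorm, Real.deriv_log, norm_inv,
        Real.norm_of_nonneg (hdpos.le.trans ht), Real.coe_toNNReal _ (inv_nonneg.2 hdpos.le)]
      exact inv_anti₀ hdpos ht
    exact hl.comp hNlip fun t _ => hdN t
  have hac := hlog.absolutelyContinuousOnInterval
  have hftc := hac.integral_deriv_eq_sub
  simp only [hN, ha, hb, sub_self, norm_zero, add_zero] at hftc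
  rw [← hftc]
  refine intervalIntegral.integral_mono_ae_restrict hab hac.intervalIntegrable_deriv hint ?_
  have hne' : ∀ᵐ t, t ≠ a ∧ t ≠ b := by
    filter_upwards [volume.ae_ne a, volume.ae_ne b] with t h1 h2 using ⟨h1, h2⟩
  refine (ae_restrict_iff' measurableSet_Icc).2 ?_
  filter_upwards [hNlip.absolutelyContinuousOnInterval.ae_differentiableAt,
    hK.ae_differentiableWithinAt_of_mem_real, hne'] with t h1 h2 h3 ht
  have hI : Icc a b ∈ 𝓝 t :=
    Icc_mem_nhds (lt_of_le_of_ne ht.1 h3.1.symm) (lt_of_le_of_ne ht.2 h3.2)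
  have hγd := (h2 ht).differentiableAt hI
  have hNd : DifferentiableAt ℝ N t := h1 (by rwa [uIcc_of_le hab])
  have hder : deriv (fun t => Real.log (N t)) t = deriv N t / N t :=
    (hNd.hasDerivAt.log (hNpos t).ne').deriv
  have hδ : infDist (γ t) Ωᶜ ≤ N t := by
    rw [hN, hd]
    simpa [dist_eq_norm] using infDist_le_infDist_add_dist (s := Ωᶜ) (x := γ t) (y := x)
  change deriv (fun t => Real.log (N t)) t ≤ _
  rw [hder]
  calc deriv N t / N t ≤ ‖deriv γ t‖ / N t := by
        gcongr
        · exact (le_abs_self _).trans (abs_deriv_norm_sub_le hγd hNd)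
    _ ≤ ‖deriv γ t‖ / infDist (γ t) Ωᶜ :=
        div_le_div_of_nonneg_left (norm_nonneg _) (infDist_compl_pos hO hne (hmem t ht)) hδ

lemma dist_le_exp_qhDist (hO : IsOpen Ω) (hne : Ωᶜ.Nonempty) (hc : IsPreconnected Ω)
    (hx : x ∈ Ω) (hy : y ∈ Ω) :
    dist x y ≤ (Real.exp (qhDist Ω x y) - 1) * infDist x Ωᶜ := by
  have hpos := infDist_compl_pos hO hne hx
  have hlog : Real.log (infDist x Ωᶜ + ‖y - x‖) - Real.log (infDist x Ωᶜ) ≤ qhDist Ω x y := by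
    refine le_of_forall_pos_le_add fun ε hε => ?_
    obtain ⟨γ, a, b, h, hl⟩ := exists_qhLength_lt hO hne hc hx hy hε
    exact (log_le_qhLength hO hne h).trans hl.le
  have h2 : Real.log (infDist x Ωᶜ + ‖y - x‖) ≤ qhDist Ω x y + Real.log (infDist x Ωᶜ) := by
    linarith
  rw [Real.log_le_iff_le_exp (by positivity), Real.exp_add, Real.exp_log hpos] at h2
  rw [dist_comm, dist_eq_norm]
  linarith

lemma eq_of_qhDist_eq_zero (hO : IsOpen Ω) (hne : Ωᶜ.Nonempty) (hc : IsPreconnected Ω)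
    (hx : x ∈ Ω) (hy : y ∈ Ω) (h : qhDist Ω x y = 0) : x = y := by
  have := dist_le_exp_qhDist hO hne hc hx hy
  rw [h, Real.exp_zero, sub_self, zero_mul] at this
  exact dist_le_zero.1 this

lemma eventually_qhDist_lt (hO : IsOpen Ω) (hne : Ωᶜ.Nonempty) (hx : x ∈ Ω) {ε : ℝ}
    (hε : 0 < ε) : ∀ᶠ y in 𝓝 x, y ∈ Ω ∧ qhDist Ω x y < ε := by
  have hpos := infDist_compl_pos hO hne hx
  have hcont : ContinuousAt (fun y => dist x y / (infDist x Ωᶜ - dist x y)) x := by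
    refine ContinuousAt.div (by fun_prop) (by fun_prop) ?_
    simpa using hpos.ne'
  have h0 : ∀ᶠ y in 𝓝 x, dist x y / (infDist x Ωᶜ - dist x y) < ε :=
    hcont.eventually_lt continuousAt_const (by simpa)
  filter_upwards [h0, ball_mem_nhds x hpos] with y hy hy'
  exact ⟨ball_infDist_compl_subset hy',
    (qhDist_le_of_dist_lt hO hne (by rwa [dist_comm])).trans_lt hy⟩

lemma continuousOn_qhDist (hO : IsOpen Ω) (hne : Ωᶜ.Nonempty) (hc : IsPreconnected Ω)
    (hz : z ∈ Ω) : ContinuousOn (qhDist Ω z) Ω := by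
  intro x hx
  refine Metric.continuousWithinAt_iff'.2 fun ε hε => ?_
  filter_upwards [mem_nhdsWithin_of_mem_nhds (eventually_qhDist_lt hO hne hx hε)] with y hy
  have h1 := qhDist_triangle hO hne hc hz hx hy.1
  have h2 := qhDist_triangle hO hne hc hz hy.1 hx
  rw [qhDist_comm Ω y x] at h2
  rw [Real.dist_eq, abs_lt]
  constructor <;> linarith [hy.2]

/-- Discrete rough geodesics: points of `Ω` can be joined by chains which follow a nearly
length-minimizing path in unit steps. -/
lemma exists_rough_geodesic (hO : IsOpen Ω) (hne : Ωᶜ.Nonempty) (hc : IsPreconnected Ω)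
    (hz : z ∈ Ω) (hw : w ∈ Ω) :
    ∃ (T : ℕ) (a : ℕ → E), a 0 = z ∧ a (T + 1) = w ∧ (∀ i, a i ∈ Ω) ∧
      ∀ i ≤ T, qhDist Ω z (a i) = i ∧ qhDist Ω (a i) (a (i + 1)) ≤ 2 ∧
        qhDist Ω (a i) w ≤ qhDist Ω z w - i + 1 := by
  obtain ⟨γ, α, β, h, hl⟩ := exists_qhLength_lt hO hne hc hz hw one_pos
  obtain ⟨hab, hα, hβ, hmem, K, hK⟩ := id h
  have hsplit : ∀ s ∈ Icc α β, ∀ t ∈ Icc α β, s ≤ t →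
      qhDist Ω z (γ s) + qhDist Ω (γ s) (γ t) + qhDist Ω (γ t) w ≤ qhDist Ω z w + 1 := by
    intro s hs t ht hst
    have e1 := qhLength_add hO hne h ht
    have e2 := qhLength_add hO hne (h.mono le_rfl ht.1 ht.2) ⟨hs.1, hst⟩
    have f1 := qhDist_le_qhLength (h.mono le_rfl hs.1 hs.2)
    have f2 := qhDist_le_qhLength (h.mono hs.1 hst ht.2)
    have f3 := qhDist_le_qhLength (h.mono ht.1 ht.2 le_rfl)
    rw [hα] at f1
    rw [hβ] at f3
    linarith
  have hcont : ContinuousOn (fun t => qhDist Ω z (γ t)) (Icc α β) :=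
    (continuousOn_qhDist hO hne hc hz).comp hK.continuousOn hmem
  have hivt := intermediate_value_Icc hab hcont
  simp only [hα, hβ, qhDist_self hO hne hz] at hivt
  set T := ⌊qhDist Ω z w⌋₊ with hT
  have hTle : (T : ℝ) ≤ qhDist Ω z w := Nat.floor_le (qhDist_nonneg _ _ _)
  have hlt : qhDist Ω z w < T + 1 := Nat.lt_floor_add_one _
  have hex : ∀ i : ℕ, ∃ t ∈ Icc α β, i ≤ T → qhDist Ω z (γ t) = i := by
    intro i
    by_cases hi : i ≤ T
    · obtain ⟨t, ht, hti⟩ := hivt ⟨Nat.cast_nonneg i, (Nat.cast_le.2 hi).trans hTle⟩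
      exact ⟨t, ht, fun _ => hti⟩
    · exact ⟨α, ⟨le_rfl, hab⟩, fun h => absurd h hi⟩
  choose τ hτ hτi using hex
  refine ⟨T, fun i => if i ≤ T then γ (τ i) else w, ?_, by simp, fun i => ?_, fun i hi => ?_⟩
  · have := hτi 0 (Nat.zero_le _)
    simp only [Nat.zero_le, if_true]
    exact (eq_of_qhDist_eq_zero hO hne hc hz (hmem _ (hτ 0)) (by simpa using this)).symm
  · dsimp only
    split_ifs
    exacts [hmem _ (hτ i), hw]
  · have hiw : qhDist Ω (γ (τ i)) w ≤ qhDist Ω z w - i + 1 := by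
      have := hsplit _ (hτ i) _ (hτ i) le_rfl
      rw [hτi i hi] at this
      linarith [qhDist_nonneg Ω (γ (τ i)) (γ (τ i))]
    simp only [hi, if_true]
    refine ⟨hτi i hi, ?_, hiw⟩
    by_cases hi1 : i + 1 ≤ T
    · simp only [hi1, if_true]
      have k1 := hτi i hi
      have k2 := hτi (i + 1) hi1
      push_cast at k2
      have tri1 := qhDist_triangle hO hne hc hz (hmem _ (hτ (i + 1))) hw
      have tri2 := qhDist_triangle hO hne hc hz (hmem _ (hτ i)) hw
      rcases le_total (τ i) (τ (i + 1)) with hle | hle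
      · have := hsplit _ (hτ i) _ (hτ (i + 1)) hle
        linarith
      · have := hsplit _ (hτ (i + 1)) _ (hτ i) hle
        rw [qhDist_comm Ω (γ (τ i))]
        linarith
    · simp only [hi1, if_false]
      have : (T : ℝ) = i := by
        congr 1
        omega
      linarith

end QuasihyperbolicDistance

section Visual

/-- Frink's metrization lemma for the quasi-ultrametric attached to a hyperbolic product. -/
lemma exists_visual_dist {X : Type*} (P : X → X → ℝ) (hsymm : ∀ x y, P x y = P y x) {δ ε : ℝ}
    (hP : ∀ x y z, min (P x y) (P y z) - δ ≤ P x z) (hε : 0 < ε) (hεδ : 2 * (ε * δ) ≤ Real.log 2) :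
    ∃ D : X → X → ℝ, (∀ x, D x x = 0) ∧ (∀ x y z, D x z ≤ D x y + D y z) ∧
      (∀ x y, D x y ≤ Real.exp (-ε * P x y)) ∧
      ∀ x y, x ≠ y → Real.exp (-ε * P x y) ≤ 2 * D x y := by
  classical
  let q : X → X → ℝ≥0 := fun x y => if x = y then 0 else Real.toNNReal (Real.exp (-ε * P x y))
  have hq0 : ∀ x, q x x = 0 := fun x => if_pos rfl
  have hqne : ∀ x y, x ≠ y → (q x y : ℝ) = Real.exp (-ε * P x y) := fun x y h => by
    simp only [q, if_neg h]
    exact Real.coe_toNNReal _ (Real.exp_pos _).le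
  have hqle : ∀ x y, (q x y : ℝ) ≤ Real.exp (-ε * P x y) := fun x y => by
    by_cases h : x = y
    · subst h
      rw [hq0]
      exact (Real.exp_pos _).le
    · exact (hqne x y h).le
  have hqs : ∀ x y, q x y = q y x := fun x y => by
    simp only [q, eq_comm (a := x), hsymm x y]
  set s : ℝ≥0 := Real.toNNReal (Real.exp (ε * δ)) with hs
  have hsv : (s : ℝ) = Real.exp (ε * δ) := Real.coe_toNNReal _ (Real.exp_pos _).le
  have hss : s * s ≤ 2 := by
    rw [← NNReal.coe_le_coe, NNReal.coe_mul, hsv, ← Real.exp_add, NNReal.coe_ofNat,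
      ← Real.le_log_iff_exp_le two_pos]
    linarith
  have hδ : ∀ x : X, 0 ≤ δ := fun x => by
    have := hP x x x
    rw [min_self] at this
    linarith
  have h3 : ∀ x y z, q x z ≤ s * max (q x y) (q y z) := by
    intro x y z
    have hs1 : 1 ≤ s := by
      rw [← NNReal.coe_le_coe, hsv, NNReal.coe_one]
      exact Real.one_le_exp (mul_nonneg hε.le (hδ x))
    by_cases hxz : x = z
    · subst hxz
      simp [hq0]
    by_cases hxy : x = y
    · subst hxy
      simpa [hq0] using le_mul_of_one_le_left zero_le hs1
    by_cases hyz : y = z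
    · subst hyz
      simpa [hq0] using le_mul_of_one_le_left zero_le hs1
    rw [← NNReal.coe_le_coe, NNReal.coe_mul, NNReal.coe_max, hqne _ _ hxz, hqne _ _ hxy,
      hqne _ _ hyz, hsv]
    rcases le_total (P x y) (P y z) with h | h
    · have := hP x y z
      rw [min_eq_left h] at this
      refine le_trans ?_ (mul_le_mul_of_nonneg_left (le_max_left _ _) (Real.exp_pos _).le)
      rw [← Real.exp_add]
      exact Real.exp_le_exp.2 (by nlinarith)
    · have := hP x y z
      rw [min_eq_right h] at this
      refine le_trans ?_ (mul_le_mul_of_nonneg_left (le_max_right _ _) (Real.exp_pos _).le)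
      rw [← Real.exp_add]
      exact Real.exp_le_exp.2 (by nlinarith)
  have h4 : ∀ x₁ x₂ x₃ x₄, q x₁ x₄ ≤ 2 * max (q x₁ x₂) (max (q x₂ x₃) (q x₃ x₄)) := by
    intro x₁ x₂ x₃ x₄
    set m := max (q x₁ x₂) (max (q x₂ x₃) (q x₃ x₄)) with hm
    have hs1 : 1 ≤ s := by
      rw [← NNReal.coe_le_coe, hsv, NNReal.coe_one]
      exact Real.one_le_exp (mul_nonneg hε.le (hδ x₁))
    calc q x₁ x₄ ≤ s * max (q x₁ x₂) (q x₂ x₄) := h3 _ _ _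
      _ ≤ s * (s * m) := by
        gcongr
        refine max_le ((le_max_left _ _).trans (le_mul_of_one_le_left zero_le hs1)) ?_
        exact (h3 _ _ _).trans (by gcongr; exact le_max_right _ _)
      _ = s * s * m := (mul_assoc _ _ _).symm
      _ ≤ 2 * m := by gcongr
  let _ := PseudoMetricSpace.ofPreNNDist q hq0 hqs
  refine ⟨dist, dist_self, dist_triangle, fun x y => ?_, fun x y hxy => ?_⟩
  · exact (PseudoMetricSpace.dist_ofPreNNDist_le q hq0 hqs x y).trans (hqle x y)
  · rw [← hqne x y hxy]
    exact PseudoMetricSpace.le_two_mul_dist_ofPreNNDist q hq0 hqs h4 x y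

/-- If the links of a chain are labelled so that the part of the chain between two links with the
same label `i` is at most `r i` wide, then the chain spans at most the sum of the `r i`. -/
lemma dist_le_sum_labels {X ι : Type*} [DecidableEq ι] {D : X → X → ℝ} (h0 : ∀ x, D x x = 0)
    (htri : ∀ x y z, D x z ≤ D x y + D y z) {r : ι → ℝ} (hr : ∀ i, 0 ≤ r i) (N : ℕ) :
    ∀ (F : Finset ι) (w : ℕ → X) (l : ℕ → ι), (∀ i < N, l i ∈ F) →
      (∀ i j, i ≤ j → j < N → l i = l j → D (w i) (w (j + 1)) ≤ r (l i)) →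
      D (w 0) (w N) ≤ ∑ i ∈ F, r i := by
  induction N using Nat.strong_induction_on with
  | _ N ih =>
    intro F w l hF hD
    rcases Nat.eq_zero_or_pos N with rfl | hN
    · rw [h0]
      exact Finset.sum_nonneg fun i _ => hr i
    obtain ⟨j, hj, hmax⟩ := Finset.exists_max_image
      ((Finset.range N).filter fun j => l 0 = l j) id ⟨0, by simp [hN]⟩
    simp only [Finset.mem_filter, Finset.mem_range, id] at hj hmax
    have hrec := ih (N - (j + 1)) (by omega) (F.erase (l 0)) (fun i => w (i + (j + 1)))
      (fun i => l (i + (j + 1))) (fun i hi => Finset.mem_erase.2 ⟨fun h => ?_, hF _ (by omega)⟩)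
      (fun i i' hii hi' hl => ?_)
    · have h1 := hD 0 j (Nat.zero_le _) hj.1 hj.2
      have h2 := htri (w 0) (w (j + 1)) (w N)
      rw [← Finset.add_sum_erase F r (hF 0 hN)]
      have e : N - (j + 1) + (j + 1) = N := by omega
      simp only [zero_add, e] at hrec
      linarith
    · have := hmax (i + (j + 1)) ⟨by omega, h.symm⟩
      omega
    · have := hD (i + (j + 1)) (i' + (j + 1)) (by omega) (by omega) hl
      convert this using 3
      omega

end Visual

section Packing

variable [FiniteDimensional ℝ E]

lemma sum_pow_le_of_disjoint_balls (B : Finset E) (ρ : E → ℝ) (hρ : ∀ b ∈ B, 0 < ρ b)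
    (hd : (B : Set E).PairwiseDisjoint fun b => ball b (ρ b)) {ξ : E} {S : ℝ} (hS : 0 < S)
    (hsub : ∀ b ∈ B, ball b (ρ b) ⊆ ball ξ S) :
    ∑ b ∈ B, ρ b ^ Module.finrank ℝ E ≤ S ^ Module.finrank ℝ E := by
  borelize E
  set μ : Measure E := Measure.addHaar
  have h1 : ∑ b ∈ B, μ (ball b (ρ b)) ≤ μ (ball ξ S) := by
    rw [← measure_biUnion_finset hd fun b _ => measurableSet_ball]
    exact measure_mono (iUnion₂_subset hsub)
  have hpos : μ (ball 0 1) ≠ 0 := (measure_ball_pos μ 0 one_pos).ne'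
  have hfin : μ (ball 0 1) ≠ ⊤ := measure_ball_lt_top.ne
  rw [Measure.addHaar_ball_of_pos μ ξ hS, Finset.sum_congr rfl fun b hb =>
    Measure.addHaar_ball_of_pos μ b (hρ b hb), ← Finset.sum_mul, ENNReal.mul_le_mul_iff_left hpos hfin,
    ← ENNReal.ofReal_sum_of_nonneg fun b hb => pow_nonneg (hρ b hb).le _,
    ENNReal.ofReal_le_ofReal_iff (by positivity)] at h1
  exact h1

/-- The number of balls `ball b (δ b / 8)`, counted with the weight `(δ b / dist b ξ) ^ n`, is at
most logarithmic in the ratio of the radii of the annulus containing their centres. -/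
lemma sum_ratio_pow_le (B : Finset E) (δ : E → ℝ) {ξ : E} {s S : ℝ} (hs : 0 < s) (hsS : s ≤ S)
    (hδ : ∀ b ∈ B, 0 < δ b) (hδξ : ∀ b ∈ B, δ b ≤ dist b ξ)
    (hd : (B : Set E).PairwiseDisjoint fun b => ball b (δ b / 8))
    (hB : ∀ b ∈ B, s ≤ dist b ξ ∧ dist b ξ ≤ S) :
    ∑ b ∈ B, (δ b / dist b ξ) ^ Module.finrank ℝ E ≤
      32 ^ Module.finrank ℝ E * (Real.logb 2 (S / s) + 1) := by
  classical
  set n := Module.finrank ℝ E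
  set J := ⌊Real.logb 2 (S / s)⌋₊ with hJ
  have hlog0 : 0 ≤ Real.logb 2 (S / s) :=
    Real.logb_nonneg one_lt_two ((one_le_div hs).2 hsS)
  let f : E → ℕ := fun b => ⌊Real.logb 2 (dist b ξ / s)⌋₊
  have hf : ∀ b ∈ B, f b ∈ Finset.range (J + 1) := by
    intro b hb
    obtain ⟨h1, h2⟩ := hB b hb
    refine Finset.mem_range.2 (Nat.lt_succ_of_le (Nat.floor_le_floor ?_))
    exact Real.logb_le_logb_of_le one_lt_two (div_pos (hs.trans_le h1) hs) (by gcongr)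
  have hfb : ∀ b ∈ B, 2 ^ f b * s ≤ dist b ξ ∧ dist b ξ ≤ 2 ^ (f b + 1) * s := by
    intro b hb
    obtain ⟨h1, h2⟩ := hB b hb
    have hpos : 0 < dist b ξ / s := div_pos (hs.trans_le h1) hs
    have h3 : (f b : ℝ) ≤ Real.logb 2 (dist b ξ / s) :=
      Nat.floor_le (Real.logb_nonneg one_lt_two ((one_le_div hs).2 h1))
    have h4 : Real.logb 2 (dist b ξ / s) ≤ ((f b + 1 : ℕ) : ℝ) := by
      push_cast
      exact (Nat.lt_floor_add_one _).le
    rw [Real.le_logb_iff_rpow_le one_lt_two hpos, Real.rpow_natCast, le_div_iff₀ hs] at h3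
    rw [Real.logb_le_iff_le_rpow one_lt_two hpos, Real.rpow_natCast, div_le_iff₀ hs] at h4
    exact ⟨h3, h4⟩
  have hfib : ∀ j ∈ Finset.range (J + 1),
      ∑ b ∈ B.filter (fun b => f b = j), (δ b / dist b ξ) ^ n ≤ 32 ^ n := by
    intro j _
    have hsub : ∀ b ∈ B.filter (fun b => f b = j), b ∈ B := fun b hb => (Finset.mem_filter.1 hb).1
    have hsp : 0 < 2 ^ j * s := by positivity
    have h1 := sum_pow_le_of_disjoint_balls (B.filter fun b => f b = j) (fun b => δ b / 8)
      (fun b hb => by have := hδ b (hsub b hb); positivity)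
      (hd.subset fun b hb => hsub b hb) (ξ := ξ) (S := 4 * (2 ^ j * s)) (by positivity) ?_
    · calc ∑ b ∈ B.filter (fun b => f b = j), (δ b / dist b ξ) ^ n
          ≤ ∑ b ∈ B.filter (fun b => f b = j), (8 / (2 ^ j * s)) ^ n * (δ b / 8) ^ n := by
            refine Finset.sum_le_sum fun b hb => ?_
            rw [← mul_pow]
            have hb1 := (hfb b (hsub b hb)).1
            rw [(Finset.mem_filter.1 hb).2] at hb1
            have hδb := hδ b (hsub b hb)
            refine pow_le_pow_left₀ (by positivity) ?_ _
            calc δ b / dist b ξ ≤ δ b / (2 ^ j * s) := by gcongr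
              _ = _ := by ring
        _ ≤ (8 / (2 ^ j * s)) ^ n * (4 * (2 ^ j * s)) ^ n := by
            rw [← Finset.mul_sum]
            gcongr
        _ = 32 ^ n := by
            rw [← mul_pow]
            congr 1
            field_simp
            norm_num
    · intro b hb w hw
      have hb2 := (hfb b (hsub b hb)).2
      rw [(Finset.mem_filter.1 hb).2, pow_succ] at hb2
      have h3 := hδξ b (hsub b hb)
      rw [mem_ball] at hw ⊢
      linarith [dist_triangle w b ξ]
  rw [← Finset.sum_fiberwise_of_maps_to hf]
  refine (Finset.sum_le_sum hfib).trans ?_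
  rw [Finset.sum_const, Finset.card_range, nsmul_eq_mul, mul_comm]
  gcongr
  push_cast
  linarith [Nat.floor_le hlog0]

end Packing

section Capacity

lemma exists_large_step {f : ℕ → ℝ} {T : ℕ} {Λ α : ℝ} (hΛ : 0 < Λ)
    (h : Λ ≤ |f (T + 1) - f 0|) :
    ∃ i ≤ T, (1 - Real.exp (-α)) * Λ * Real.exp (-α * i) ≤ |f (i + 1) - f i| := by
  by_contra! hcon
  have hq0 : 0 < Real.exp (-α) := Real.exp_pos _
  have h1 : |f (T + 1) - f 0| ≤ ∑ i ∈ Finset.range (T + 1), |f (i + 1) - f i| := by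
    rw [← Finset.sum_range_sub]
    exact Finset.abs_sum_le_sum_abs _ _
  have h2 : ∑ i ∈ Finset.range (T + 1), |f (i + 1) - f i| <
      ∑ i ∈ Finset.range (T + 1), (1 - Real.exp (-α)) * Λ * Real.exp (-α) ^ i := by
    refine Finset.sum_lt_sum_of_nonempty (by simp) fun i hi => ?_
    rw [← Real.exp_nat_mul, mul_comm (i : ℝ)]
    exact hcon i (Nat.lt_succ_iff.1 (Finset.mem_range.1 hi))
  have h3 := mul_neg_geom_sum (Real.exp (-α)) (T + 1)
  rw [← Finset.mul_sum, mul_right_comm, h3] at h2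
  nlinarith [pow_pos hq0 (T + 1)]

lemma clip_log_sub_le {r R P P' d : ℝ} (hP : 0 < P) (hP' : 0 < P')
    (h : |P - P'| ≤ 7 * d) (h' : |P - P'| ≤ 7 * P') :
    |max (Real.log r) (min (Real.log R) (Real.log P')) -
      max (Real.log r) (min (Real.log R) (Real.log P))| ≤ 56 * (d / P) := by
  have hclip : ∀ a b u v : ℝ, |max a (min b u) - max a (min b v)| ≤ |u - v| := fun a b u v =>
    (abs_max_sub_max_le_max _ _ _ _).trans <| max_le (by simp) <|
      (abs_min_sub_min_le_max _ _ _ _).trans <| max_le (by simp) le_rfl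
  refine (hclip _ _ _ _).trans ?_
  obtain ⟨h1, h2⟩ := abs_le.1 h
  obtain ⟨h3, h4⟩ := abs_le.1 h'
  have hd : 0 ≤ d := by linarith [abs_nonneg (P - P')]
  have hlog : ∀ {u v : ℝ}, 0 < u → 0 < v → Real.log u - Real.log v ≤ (u - v) / v := by
    intro u v hu hv
    rw [← Real.log_div hu.ne' hv.ne', sub_div, div_self hv.ne']
    exact Real.log_le_sub_one_of_pos (div_pos hu hv)
  refine abs_le.2 ⟨?_, ?_⟩
  · have : (P - P') / P' ≤ 56 * (d / P) := by
      rw [← mul_div_assoc, div_le_div_iff₀ hP' hP]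
      nlinarith
    linarith [hlog hP hP']
  · have : (P' - P) / P ≤ 56 * (d / P) := by
      rw [← mul_div_assoc]
      gcongr
      linarith
    linarith [hlog hP' hP]

lemma mem_annulus_of_clip_log_ne {r R P P' : ℝ} (hr : 0 < r) (hrR : r ≤ R) (hP : 0 < P)
    (hP' : 0 < P') (h : |P - P'| ≤ 7 * P) (h' : |P - P'| ≤ 7 * P')
    (hne : max (Real.log r) (min (Real.log R) (Real.log P')) ≠
      max (Real.log r) (min (Real.log R) (Real.log P))) :
    r / 8 ≤ P ∧ P ≤ 8 * R := by
  obtain ⟨h1, h2⟩ := abs_le.1 h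
  obtain ⟨h3, h4⟩ := abs_le.1 h'
  constructor
  · by_contra! hcon
    refine hne ?_
    rw [max_eq_left ((min_le_right _ _).trans (Real.log_le_log hP' (by linarith))),
      max_eq_left ((min_le_right _ _).trans (Real.log_le_log hP (by linarith)))]
  · by_contra! hcon
    refine hne ?_
    have hR : 0 < R := hr.trans_le hrR
    rw [min_eq_left (Real.log_le_log hR (by linarith)),
      min_eq_left (Real.log_le_log hR (by linarith))]

variable [CompleteSpace E] [FiniteDimensional ℝ E] {Ω : Set E} {x y z w ξ : E}

lemma dist_le_of_qhDist_le_two (hO : IsOpen Ω) (hne : Ωᶜ.Nonempty) (hc : IsPreconnected Ω)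
    (hx : x ∈ Ω) (hy : y ∈ Ω) (h : qhDist Ω x y ≤ 2) : dist x y ≤ 7 * infDist x Ωᶜ := by
  refine (dist_le_exp_qhDist hO hne hc hx hy).trans ?_
  refine mul_le_mul_of_nonneg_right ?_ infDist_nonneg
  have h2 : Real.exp 2 = Real.exp 1 * Real.exp 1 := by
    rw [← Real.exp_add]
    norm_num
  have := Real.exp_le_exp.2 h
  nlinarith [Real.exp_one_lt_d9, Real.exp_pos 1]

/-- If `z` and `w` are on different sides of an annulus around a point `ξ` outside `Ω`, then some
point of a rough geodesic from `z` to `w` contributes a substantial part of the logarithmic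
oscillation. -/
lemma exists_substantial_point (hO : IsOpen Ω) (hne : Ωᶜ.Nonempty) (hc : IsPreconnected Ω)
    (hξ : ξ ∈ Ωᶜ) (hz : z ∈ Ω) (hw : w ∈ Ω) {r R α : ℝ} (hr : 0 < r) (hrR : r < R) (hα : 0 < α)
    (h : (dist z ξ ≤ r ∧ R ≤ dist w ξ) ∨ (R ≤ dist z ξ ∧ dist w ξ ≤ r)) :
    ∃ a ∈ Ω, (r / 8 ≤ dist a ξ ∧ dist a ξ ≤ 8 * R) ∧
      (1 - Real.exp (-α)) * Real.log (R / r) * Real.exp (-α * qhDist Ω z a) ≤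
        56 * (infDist a Ωᶜ / dist a ξ) ∧
      qhDist Ω z a + qhDist Ω a w ≤ qhDist Ω z w + 1 := by
  obtain ⟨T, a, ha0, haT, hmem, ha⟩ := exists_rough_geodesic hO hne hc hz hw
  have hR : 0 < R := hr.trans hrR
  have hΛ : 0 < Real.log (R / r) := Real.log_pos ((one_lt_div hr).2 hrR)
  have hpos : ∀ p ∈ Ω, 0 < dist p ξ := fun p hp => dist_pos.2 fun h => hξ (h ▸ hp)
  have hlrR : Real.log r ≤ Real.log R := Real.log_le_log hr hrR.le
  have hlow : ∀ p ∈ Ω, dist p ξ ≤ r →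
      max (Real.log r) (min (Real.log R) (Real.log (dist p ξ))) = Real.log r := fun p hp h =>
    max_eq_left ((min_le_right _ _).trans (Real.log_le_log (hpos p hp) h))
  have hhigh : ∀ p ∈ Ω, R ≤ dist p ξ →
      max (Real.log r) (min (Real.log R) (Real.log (dist p ξ))) = Real.log R := fun p hp h => by
    rw [min_eq_left (Real.log_le_log hR h), max_eq_right hlrR]
  obtain ⟨i, hi, hstep⟩ := exists_large_step
    (f := fun i => max (Real.log r) (min (Real.log R) (Real.log (dist (a i) ξ)))) (T := T) hΛ (by
      simp only [ha0, haT]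
      rw [Real.log_div hR.ne' hr.ne']
      rcases h with ⟨h1, h2⟩ | ⟨h1, h2⟩
      · rw [hlow z hz h1, hhigh w hw h2]
        exact le_abs_self _
      · rw [hlow w hw h2, hhigh z hz h1, abs_sub_comm]
        exact le_abs_self _)
  obtain ⟨hk, hk2, hkw⟩ := ha i hi
  have d1 := dist_le_of_qhDist_le_two hO hne hc (hmem i) (hmem (i + 1)) hk2
  have d2 := dist_le_of_qhDist_le_two hO hne hc (hmem (i + 1)) (hmem i) (by rwa [qhDist_comm])
  rw [dist_comm] at d2
  have i1 : infDist (a i) Ωᶜ ≤ dist (a i) ξ := infDist_le_dist_of_mem hξ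
  have i2 : infDist (a (i + 1)) Ωᶜ ≤ dist (a (i + 1)) ξ := infDist_le_dist_of_mem hξ
  have hPP : |dist (a i) ξ - dist (a (i + 1)) ξ| ≤ dist (a i) (a (i + 1)) := abs_dist_sub_le _ _ _
  refine ⟨a i, hmem i, ?_, ?_, by linarith⟩
  · refine mem_annulus_of_clip_log_ne hr hrR.le (hpos _ (hmem i)) (hpos _ (hmem (i + 1)))
      (by linarith) (by linarith) fun heq => ?_
    simp only [heq, sub_self, abs_zero] at hstep
    have : 0 < 1 - Real.exp (-α) := by
      rw [sub_pos, Real.exp_lt_one_iff]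
      linarith
    exact hstep.not_gt (by positivity)
  · rw [hk]
    exact hstep.trans (clip_log_sub_le (hpos _ (hmem i)) (hpos _ (hmem (i + 1)))
      (by linarith) (by linarith))

lemma exists_qh_chain (hO : IsOpen Ω) (hne : Ωᶜ.Nonempty) {C : Set E} (hC : IsPreconnected C)
    (hCΩ : C ⊆ Ω) (hx : x ∈ C) (hy : y ∈ C) :
    ∃ (N : ℕ) (w : ℕ → E), w 0 = x ∧ w N = y ∧ (∀ i, w i ∈ C) ∧
      ∀ i < N, qhDist Ω (w i) (w (i + 1)) < 1 := by
  refine hC.induction₂ (fun x y => ∃ (N : ℕ) (w : ℕ → E), w 0 = x ∧ w N = y ∧ (∀ i, w i ∈ C) ∧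
    ∀ i < N, qhDist Ω (w i) (w (i + 1)) < 1) (fun x hx => ?_) ?_ ?_ hx hy
  · filter_upwards [self_mem_nhdsWithin, mem_nhdsWithin_of_mem_nhds
      (eventually_qhDist_lt hO hne (hCΩ hx) one_pos)] with y hy hxy
    refine ⟨1, fun i => if i = 0 then x else y, by simp, by simp, fun i => ?_, fun i hi => ?_⟩
    · dsimp only
      split_ifs
      exacts [hx, hy]
    · obtain rfl : i = 0 := by omega
      simpa using hxy.2
  · rintro x y z - - - ⟨N, w, rfl, rfl, hm, hs⟩ ⟨N', w', h0, rfl, hm', hs'⟩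
    refine ⟨N + N', fun i => if i ≤ N then w i else w' (i - N), by simp, ?_, fun i => ?_,
      fun i hi => ?_⟩
    · rcases Nat.eq_zero_or_pos N' with rfl | h
      · simp [h0]
      · simp [h.ne']
    · dsimp only
      split_ifs
      exacts [hm _, hm' _]
    · rcases lt_trichotomy i N with h | rfl | h
      · simpa [h.le, Nat.succ_le_of_lt h] using hs i h
      · simpa [← h0] using hs' 0 (by omega)
      · have e : i + 1 - N = i - N + 1 := by omega
        simpa [h.not_ge, (h.trans (Nat.lt_succ_self i)).not_ge, e] using hs' (i - N) (by omega)
  · rintro x y - - ⟨N, w, rfl, rfl, hm, hs⟩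
    refine ⟨N, fun i => w (N - i), by simp, by simp, fun i => hm _, fun i hi => ?_⟩
    have := hs (N - (i + 1)) (by omega)
    rwa [qhDist_comm, show N - (i + 1) + 1 = N - i by omega] at this

lemma exists_maximal_separated {X : Type*} [DecidableEq X] (k : X → X → ℝ)
    (hk : ∀ a b, k a b = k b a) (A : Finset X) (h0 : ∀ a ∈ A, k a a < 1) :
    ∃ B ⊆ A, (∀ b ∈ B, ∀ b' ∈ B, b ≠ b' → 1 ≤ k b b') ∧ ∀ a ∈ A, ∃ b ∈ B, k a b < 1 := by
  induction A using Finset.induction_on with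
  | empty => exact ⟨∅, by simp⟩
  | insert a A _ ih =>
    obtain ⟨B, hBA, hsep, hnet⟩ := ih fun b hb => h0 b (Finset.mem_insert_of_mem hb)
    by_cases h : ∃ b ∈ B, k a b < 1
    · refine ⟨B, hBA.trans (Finset.subset_insert _ _), hsep, fun c hc => ?_⟩
      rcases Finset.mem_insert.1 hc with rfl | hc
      exacts [h, hnet c hc]
    · push Not at h
      refine ⟨insert a B, Finset.insert_subset_insert _ hBA, fun b hb b' hb' hbb' => ?_,
        fun c hc => ?_⟩
      · rcases Finset.mem_insert.1 hb with rfl | hbB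
        · exact h _ ((Finset.mem_insert.1 hb').resolve_left (Ne.symm hbb'))
        · rcases Finset.mem_insert.1 hb' with rfl | hbB'
          · rw [hk]
            exact h _ hbB
          · exact hsep _ hbB _ hbB' hbb'
      · rcases Finset.mem_insert.1 hc with rfl | hc
        · exact ⟨c, Finset.mem_insert_self _ _, h0 c (Finset.mem_insert_self _ _)⟩
        · obtain ⟨b, hb, hcb⟩ := hnet c hc
          exact ⟨b, Finset.mem_insert_of_mem hb, hcb⟩

lemma disjoint_balls_of_one_le_qhDist (hO : IsOpen Ω) (hne : Ωᶜ.Nonempty) (hx : x ∈ Ω)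
    (hy : y ∈ Ω) (h : 1 ≤ qhDist Ω x y) :
    Disjoint (ball x (infDist x Ωᶜ / 8)) (ball y (infDist y Ωᶜ / 8)) := by
  wlog hxy : infDist y Ωᶜ ≤ infDist x Ωᶜ generalizing x y
  · exact (this hy hx (by rwa [qhDist_comm]) (not_le.1 hxy).le).symm
  refine ball_disjoint_ball ?_
  by_contra! hcon
  have hpos := infDist_compl_pos hO hne hx
  have hd : dist x y < infDist x Ωᶜ / 4 := by linarith
  have h1 := qhDist_le_of_dist_lt hO hne (x := x) (y := y) (by linarith)
  have h2 : dist x y / (infDist x Ωᶜ - dist x y) < 1 := by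
    rw [div_lt_one (by linarith)]
    linarith
  linarith

end Capacity

section CapacityEstimate

variable [FiniteDimensional ℝ E]

lemma log_mul_sum_exp_le (hn : 1 ≤ Module.finrank ℝ E) (B : Finset E) (δ κ : E → ℝ) {ξ : E}
    {r R α : ℝ} (hr : 0 < r) (hrR : r < R) (hΛ : 1 ≤ Real.log (R / r)) (hα : 0 < α)
    (hδ : ∀ b ∈ B, 0 < δ b) (hδξ : ∀ b ∈ B, δ b ≤ dist b ξ)
    (hd : (B : Set E).PairwiseDisjoint fun b => ball b (δ b / 8))
    (hB : ∀ b ∈ B, r / 8 ≤ dist b ξ ∧ dist b ξ ≤ 8 * R)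
    (hκ : ∀ b ∈ B, (1 - Real.exp (-α)) * Real.log (R / r) * Real.exp (-α * κ b) ≤
      56 * (δ b / dist b ξ)) :
    Real.log (R / r) * ∑ b ∈ B, Real.exp (-α * κ b) ^ (Module.finrank ℝ E + 1) ≤
      (56 / (1 - Real.exp (-α))) ^ (Module.finrank ℝ E + 1) * (32 ^ Module.finrank ℝ E * 9) := by
  set n := Module.finrank ℝ E
  set Λ := Real.log (R / r) with hΛdef
  have hc : 0 < 1 - Real.exp (-α) := by
    rw [sub_pos, Real.exp_lt_one_iff]
    linarith
  set c := 1 - Real.exp (-α)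
  have hR : 0 < R := hr.trans hrR
  have hΛ0 : 0 < Λ := one_pos.trans_le hΛ
  have hlog : Real.logb 2 (8 * R / (r / 8)) + 1 ≤ 9 * Λ := by
    have e : 8 * R / (r / 8) = 2 ^ (6 : ℕ) * (R / r) := by
      field_simp
      norm_num
    rw [e, Real.logb_mul (by positivity) (by positivity), Real.logb_pow, Real.logb_self_eq_one
      one_lt_two]
    have : Real.logb 2 (R / r) ≤ 2 * Λ := by
      rw [Real.logb, div_le_iff₀ (Real.log_pos one_lt_two)]
      nlinarith [Real.log_two_gt_d9]
    push_cast
    linarith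
  have hterm : ∀ b ∈ B, Λ ^ 2 * Real.exp (-α * κ b) ^ (n + 1) ≤
      (56 / c) ^ (n + 1) * (δ b / dist b ξ) ^ n := by
    intro b hb
    have hb0 : 0 < dist b ξ := (hδ b hb).trans_le (hδξ b hb)
    have ht0 : 0 ≤ δ b / dist b ξ := div_nonneg (hδ b hb).le hb0.le
    calc Λ ^ 2 * Real.exp (-α * κ b) ^ (n + 1)
        ≤ Λ ^ (n + 1) * Real.exp (-α * κ b) ^ (n + 1) := by
          gcongr
          omega
      _ = (Λ * Real.exp (-α * κ b)) ^ (n + 1) := (mul_pow _ _ _).symm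
      _ ≤ (56 / c * (δ b / dist b ξ)) ^ (n + 1) := by
          refine pow_le_pow_left₀ (by positivity) ?_ _
          rw [div_mul_eq_mul_div, le_div_iff₀ hc]
          linarith [hκ b hb]
      _ = (56 / c) ^ (n + 1) * (δ b / dist b ξ) ^ (n + 1) := mul_pow _ _ _
      _ ≤ (56 / c) ^ (n + 1) * (δ b / dist b ξ) ^ n := by
          gcongr _ * ?_
          exact pow_le_pow_of_le_one ht0 ((div_le_one hb0).2 (hδξ b hb)) n.le_succ
  have hsum := sum_ratio_pow_le B δ (by positivity : 0 < r / 8) (by linarith : r / 8 ≤ 8 * R)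
    hδ hδξ hd hB
  refine le_of_mul_le_mul_left ?_ hΛ0
  calc Λ * (Λ * ∑ b ∈ B, Real.exp (-α * κ b) ^ (n + 1))
      = ∑ b ∈ B, Λ ^ 2 * Real.exp (-α * κ b) ^ (n + 1) := by
        rw [← Finset.mul_sum]
        ring
    _ ≤ ∑ b ∈ B, (56 / c) ^ (n + 1) * (δ b / dist b ξ) ^ n := Finset.sum_le_sum hterm
    _ = (56 / c) ^ (n + 1) * ∑ b ∈ B, (δ b / dist b ξ) ^ n := (Finset.mul_sum _ _ _).symm
    _ ≤ (56 / c) ^ (n + 1) * (32 ^ n * (9 * Λ)) := by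
        gcongr
        exact hsum.trans (by gcongr)
    _ = _ := by ring

lemma exists_capacity_const {Ω : Set E} (hO : IsOpen Ω) (hne : Ωᶜ.Nonempty)
    (hc : IsPreconnected Ω) (hG : QHGromovHyperbolic Ω) (hn : 1 ≤ Module.finrank ℝ E) :
    ∃ M, 1 < M ∧ ∀ ξ ∈ Ωᶜ, ∀ r R, 0 < r → M * r < R → ∀ z ∈ Ω, ∀ x ∈ Ω, ∀ y ∈ Ω, x ≠ y →
      qhDist Ω x z + qhDist Ω z y = qhDist Ω x y → ∀ C ⊆ Ω, IsPreconnected C → x ∈ C → y ∈ C →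
      ¬((dist z ξ ≤ r ∧ ∀ w ∈ C, R ≤ dist w ξ) ∨ (R ≤ dist z ξ ∧ ∀ w ∈ C, dist w ξ ≤ r)) := by
  classical
  have : CompleteSpace E := FiniteDimensional.complete ℝ E
  obtain ⟨δ, hδ, hG⟩ := hG
  set n := Module.finrank ℝ E with hndef
  set ε : ℝ := 1 / (4 * (δ + 1)) with hεdef
  have hε : 0 < ε := by positivity
  set α : ℝ := ε / (n + 1) with hαdef
  have hα : 0 < α := by positivity
  have hαε : α * (n + 1) = ε := by
    rw [hαdef]
    field_simp
  have hεδ : ε * (δ + 1) = 1 / 4 := by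
    rw [hεdef]
    field_simp
  have hc0 : 0 < 1 - Real.exp (-α) := by
    rw [sub_pos, Real.exp_lt_one_iff]
    linarith
  set K₀ : ℝ := (56 / (1 - Real.exp (-α))) ^ (n + 1) * (32 ^ n * 9) with hK₀
  have hK₀pos : 0 < K₀ := by positivity
  refine ⟨Real.exp (2 * (3 * K₀) + 1), Real.one_lt_exp_iff.2 (by positivity), ?_⟩
  intro ξ hξ r R hr hrR z hz x hx y hy hxy hgeo C hCΩ hC hxC hyC hcon
  have hrR' : r < R := lt_trans (lt_mul_of_one_lt_left hr (Real.one_lt_exp_iff.2 (by positivity))) hrR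
  have hR : 0 < R := hr.trans hrR'
  have hΛ : 2 * (3 * K₀) + 1 < Real.log (R / r) := by
    rw [Real.lt_log_iff_exp_lt (by positivity), lt_div_iff₀ hr]
    exact hrR
  obtain ⟨D, hD0, hDtri, hDle, hDge⟩ := exists_visual_dist
    (X := Ω) (fun p q => qhGromovProd Ω z p q)
    (fun p q => by
      simp only [qhGromovProd]
      rw [qhDist_comm Ω p q, qhDist_comm Ω p z, qhDist_comm Ω z q, add_comm])
    (δ := δ) (ε := ε) (fun p q s => hG z hz p p.2 q q.2 s s.2) hε
    (by nlinarith [Real.log_two_gt_d9])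
  obtain ⟨N, w, hw0, hwN, hwC, hwk⟩ := exists_qh_chain hO hne hC hCΩ hxC hyC
  have hwΩ : ∀ i, w i ∈ Ω := fun i => hCΩ (hwC i)
  have hsub : ∀ i, ∃ a ∈ Ω, (r / 8 ≤ dist a ξ ∧ dist a ξ ≤ 8 * R) ∧
      (1 - Real.exp (-α)) * Real.log (R / r) * Real.exp (-α * qhDist Ω z a) ≤
        56 * (infDist a Ωᶜ / dist a ξ) ∧
      qhDist Ω z a + qhDist Ω a (w i) ≤ qhDist Ω z (w i) + 1 := fun i =>
    exists_substantial_point hO hne hc hξ hz (hwΩ i) hr hrR' hα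
      (hcon.imp (fun h => ⟨h.1, h.2 _ (hwC i)⟩) fun h => ⟨h.1, h.2 _ (hwC i)⟩)
  choose a haΩ haann hasub hageo using hsub
  have hAΩ : ∀ b ∈ (Finset.range N).image a, ∃ i, a i = b := fun b hb =>
    (Finset.mem_image.1 hb).imp fun i hi => hi.2
  obtain ⟨B, hBA, hsep, hnet⟩ := exists_maximal_separated (qhDist Ω) (qhDist_comm Ω)
    ((Finset.range N).image a) fun b hb => by
      obtain ⟨i, rfl⟩ := hAΩ b hb
      rw [qhDist_self hO hne (haΩ i)]
      exact one_pos
  have hBa : ∀ b ∈ B, ∃ i, a i = b := fun b hb => hAΩ b (hBA hb)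
  have hBΩ : ∀ b ∈ B, b ∈ Ω := fun b hb => by
    obtain ⟨i, rfl⟩ := hBa b hb
    exact haΩ i
  have hlab : ∀ i, ∃ b, i < N → b ∈ B ∧ qhDist Ω (a i) b < 1 := fun i => by
    by_cases hi : i < N
    · obtain ⟨b, hb, h⟩ := hnet (a i) (Finset.mem_image_of_mem a (Finset.mem_range.2 hi))
      exact ⟨b, fun _ => ⟨hb, h⟩⟩
    · exact ⟨x, fun h => absurd h hi⟩
  choose l hl using hlab
  have htri : ∀ {p q s}, p ∈ Ω → q ∈ Ω → s ∈ Ω → qhDist Ω p s ≤ qhDist Ω p q + qhDist Ω q s :=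
    fun hp hq hs => qhDist_triangle hO hne hc hp hq hs
  have hstep : ∀ i j, i ≤ j → j < N → l i = l j →
      D ⟨w i, hwΩ i⟩ ⟨w (j + 1), hwΩ (j + 1)⟩ ≤ 3 * Real.exp (-ε * qhDist Ω z (l i)) := by
    intro i j hij hj hlij
    obtain ⟨hbB, hb⟩ := hl i (hij.trans_lt hj)
    obtain ⟨-, hb'⟩ := hl j hj
    rw [← hlij] at hb'
    have hbΩ := hBΩ _ hbB
    have h1 : qhDist Ω z (l i) - 3 / 2 ≤ qhGromovProd Ω z (w i) (l i) := by
      unfold qhGromovProd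
      have e1 := htri hz (haΩ i) hbΩ
      have e2 := htri (hwΩ i) (haΩ i) hbΩ
      have e3 := hageo i
      rw [qhDist_comm Ω (w i) z]
      rw [qhDist_comm Ω (w i) (a i)] at e2
      linarith
    have h2 : qhDist Ω z (l i) - 5 / 2 ≤ qhGromovProd Ω z (l i) (w (j + 1)) := by
      unfold qhGromovProd
      have e1 := htri hz (haΩ j) hbΩ
      have e2 := htri hbΩ (haΩ j) (hwΩ (j + 1))
      have e3 := hageo j
      have e4 := htri (haΩ j) (hwΩ j) (hwΩ (j + 1))
      have e5 := htri hz (hwΩ (j + 1)) (hwΩ j)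
      have e6 := hwk j hj
      rw [qhDist_comm Ω (l i) z]
      rw [qhDist_comm Ω (l i) (a j)] at e2
      rw [qhDist_comm Ω (w (j + 1)) (w j)] at e5
      linarith
    have h3 := hG z hz _ (hwΩ i) _ hbΩ _ (hwΩ (j + 1))
    have h4 : qhDist Ω z (l i) - 5 / 2 ≤
        min (qhGromovProd Ω z (w i) (l i)) (qhGromovProd Ω z (l i) (w (j + 1))) :=
      le_min (by linarith) h2
    refine (hDle _ _).trans ?_
    have h5 : -ε * qhGromovProd Ω z (w i) (w (j + 1)) ≤ 1 + -ε * qhDist Ω z (l i) := by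
      nlinarith
    refine (Real.exp_le_exp.2 h5).trans ?_
    rw [Real.exp_add]
    gcongr
    linarith [Real.exp_one_lt_d9]
  have hDsum := dist_le_sum_labels hD0 hDtri
    (r := fun b => 3 * Real.exp (-ε * qhDist Ω z b)) (fun b => by positivity) N B
    (fun i => ⟨w i, hwΩ i⟩) l (fun i hi => (hl i hi).1) hstep
  have hDxy : 1 / 2 ≤ D ⟨w 0, hwΩ 0⟩ ⟨w N, hwΩ N⟩ := by
    have h := hDge ⟨w 0, hwΩ 0⟩ ⟨w N, hwΩ N⟩ (by simpa [hw0, hwN] using hxy)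
    have h0 : qhGromovProd Ω z (w 0) (w N) = 0 := by
      rw [hw0, hwN, qhGromovProd, hgeo]
      simp
    simp only [h0, mul_zero, Real.exp_zero] at h
    linarith
  have hcap := log_mul_sum_exp_le hn B (fun b => infDist b Ωᶜ) (qhDist Ω z) hr hrR'
    (by linarith) hα (fun b hb => infDist_compl_pos hO hne (hBΩ b hb))
    (fun b _ => infDist_le_dist_of_mem hξ)
    (fun b hb b' hb' hbb' => disjoint_balls_of_one_le_qhDist hO hne (hBΩ b hb) (hBΩ b' hb')
      (hsep b hb b' hb' hbb'))
    (fun b hb => by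
      obtain ⟨i, rfl⟩ := hBa b hb
      exact haann i)
    (fun b hb => by
      obtain ⟨i, rfl⟩ := hBa b hb
      exact hasub i)
  have hexp : ∀ b, Real.exp (-α * qhDist Ω z b) ^ (n + 1) = Real.exp (-ε * qhDist Ω z b) := by
    intro b
    rw [← Real.exp_nat_mul, ← hαε]
    push_cast
    ring_nf
  simp only [← hndef, hexp] at hcap
  rw [← Finset.mul_sum] at hDsum
  nlinarith

end CapacityEstimate

section Visibility

lemma IsQuasiconvexSet.exists_isPreconnected {s : Set E} (h : IsQuasiconvexSet s) :
    ∃ A : ℝ, 1 ≤ A ∧ ∀ x ∈ s, ∀ y ∈ s, ∃ C ⊆ s, IsPreconnected C ∧ x ∈ C ∧ y ∈ C ∧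
      ∀ w ∈ C, dist w x ≤ A * dist x y := by
  obtain ⟨A, hA, h⟩ := h
  refine ⟨A, hA, fun x hx y hy => ?_⟩
  obtain ⟨γ, a, b, hab, hcont, rfl, rfl, hmem, hvar⟩ := h x hx y hy
  refine ⟨γ '' Icc a b, image_subset_iff.2 hmem, isPreconnected_Icc.image _ hcont,
    mem_image_of_mem _ ⟨le_rfl, hab⟩, mem_image_of_mem _ ⟨hab, le_rfl⟩, ?_⟩
  rintro _ ⟨t, ht, rfl⟩
  rw [← ENNReal.ofReal_le_ofReal_iff (by positivity), ← edist_dist]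
  exact (eVariationOn.edist_le γ ht ⟨le_rfl, hab⟩).trans hvar

variable [FiniteDimensional ℝ E] {Ω : Set E}

lemma IsQHGeodesicOn.continuousOn (hO : IsOpen Ω) (hne : Ωᶜ.Nonempty) (hc : IsPreconnected Ω)
    {γ : ℝ → E} {s : Set ℝ} (hγ : IsQHGeodesicOn Ω γ s) : ContinuousOn γ s := by
  have : CompleteSpace E := FiniteDimensional.complete ℝ E
  intro t ht
  refine tendsto_iff_dist_tendsto_zero.2 ?_
  have hlim : Tendsto (fun u => (Real.exp |t - u| - 1) * infDist (γ t) Ωᶜ) (𝓝[s] t) (𝓝 0) := by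
    have : Continuous fun u => (Real.exp |t - u| - 1) * infDist (γ t) Ωᶜ := by fun_prop
    simpa using (this.tendsto t).mono_left nhdsWithin_le_nhds
  refine squeeze_zero' (Eventually.of_forall fun _ => dist_nonneg) ?_ hlim
  filter_upwards [self_mem_nhdsWithin] with u hu
  rw [← hγ.2 t ht u hu, dist_comm]
  exact dist_le_exp_qhDist hO hne hc (hγ.1 t ht) (hγ.1 u hu)

lemma noGeodesicLoop_of_isQuasiconvexSet (hO : IsOpen Ω) (hne : Ωᶜ.Nonempty)
    (hc : IsPreconnected Ω) (hb : Bornology.IsBounded Ω) (hG : QHGromovHyperbolic Ω)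
    (hQC : IsQuasiconvexSet Ω) (hn : 1 ≤ Module.finrank ℝ E) : NoGeodesicLoop Ω := by
  intro γ hγ heq
  have : ProperSpace E := FiniteDimensional.proper ℝ E
  have : CompleteSpace E := FiniteDimensional.complete ℝ E
  have hγΩ : ∀ t, γ t ∈ Ω := fun t => hγ.1 t trivial
  have hγk : ∀ s t, qhDist Ω (γ s) (γ t) = |s - t| := fun s t => hγ.2 s trivial t trivial
  obtain ⟨M, hM, hcap⟩ := exists_capacity_const hO hne hc hG hn
  obtain ⟨A, hA, hcurve⟩ := hQC.exists_isPreconnected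
  obtain ⟨ξ, -, hξ⟩ := hb.isCompact_closure.exists_mapClusterPt (f := atTop) (u := γ)
    (tendsto_principal.2 (Eventually.of_forall fun t => subset_closure (hγΩ t)))
  have hξ' : MapClusterPt ξ atBot γ := (heq ▸ hξ : ξ ∈ {x | MapClusterPt x atBot γ})
  have hξΩ : ξ ∈ Ωᶜ := by
    intro hξΩ
    obtain ⟨t, ht, htξ⟩ := ((hξ.frequently (eventually_qhDist_lt hO hne hξΩ one_pos)).and_eventually
      (eventually_gt_atTop (qhDist Ω (γ 0) ξ + 1))).exists
    have h1 := qhDist_triangle hO hne hc (hγΩ 0) hξΩ (hγΩ t)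
    rw [hγk, zero_sub, abs_neg] at h1
    linarith [le_abs_self t, ht.2]
  have hR : 0 < dist (γ 0) ξ := dist_pos.2 fun h => hξΩ (h ▸ hγΩ 0)
  set R := dist (γ 0) ξ
  set r := R / (2 * M) with hrdef
  have hr : 0 < r := by positivity
  have hball : ball ξ (r / (4 * A)) ∈ 𝓝 ξ := ball_mem_nhds _ (by positivity)
  obtain ⟨t, htξ, ht⟩ := ((hξ.frequently hball).and_eventually (eventually_gt_atTop 0)).exists
  obtain ⟨s, hsξ, hs⟩ := ((hξ'.frequently hball).and_eventually (eventually_lt_atBot 0)).exists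
  rw [lt_div_iff₀ (by positivity)] at htξ hsξ
  obtain ⟨C, hCΩ, hC, hsC, htC, hCd⟩ := hcurve _ (hγΩ s) _ (hγΩ t)
  have hst : qhDist Ω (γ s) (γ t) = t - s := by
    rw [hγk, abs_sub_comm, abs_of_pos (by linarith)]
  refine hcap ξ hξΩ r R hr ?_ (γ 0) (hγΩ 0) (γ s) (hγΩ s) (γ t) (hγΩ t) ?_ ?_ C hCΩ hC hsC htC
    (Or.inr ⟨le_rfl, fun w hw => ?_⟩)
  · rw [hrdef]
    field_simp
    norm_num
  · intro h
    rw [h, qhDist_self hO hne (hγΩ t)] at hst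
    linarith
  · rw [hst, hγk, hγk, abs_of_neg (by linarith), abs_of_neg (by linarith)]
    ring
  · have h1 := hCd w hw
    have h2 := dist_triangle w (γ s) ξ
    have h3 := mul_le_mul_of_nonneg_left (dist_triangle_right (γ s) (γ t) ξ)
      (zero_le_one.trans hA)
    nlinarith [dist_nonneg (x := γ s) (y := ξ)]

lemma qhVisibilityDomain_of_isQuasiconvexSet (hO : IsOpen Ω) (hne : Ωᶜ.Nonempty)
    (hc : IsPreconnected Ω) (hb : Bornology.IsBounded Ω) (hG : QHGromovHyperbolic Ω)
    (hQC : IsQuasiconvexSet Ω) (hn : 1 ≤ Module.finrank ℝ E) : QHVisibilityDomain Ω := by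
  intro p _ q _ hpq
  have : ProperSpace E := FiniteDimensional.proper ℝ E
  have : CompleteSpace E := FiniteDimensional.complete ℝ E
  have hd : 0 < dist p q := dist_pos.2 hpq
  set d := dist p q with hddef
  have hdisj : closure (ball p (d / 4)) ∩ closure (ball q (d / 4)) = ∅ := by
    refine disjoint_iff_inter_eq_empty.1 ((closedBall_disjoint_closedBall ?_).mono
      closure_ball_subset_closedBall closure_ball_subset_closedBall)
    linarith
  refine ⟨ball p (d / 4), ball q (d / 4), isOpen_ball, isOpen_ball, mem_ball_self (by positivity),
    mem_ball_self (by positivity), hdisj, ?_⟩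
  by_contra! hcon
  have hstep : ∀ m : ℕ, ∃ (γ : ℝ → E) (T t : ℝ), IsQHGeodesicOn Ω γ (Icc 0 T) ∧ t ∈ Icc 0 T ∧
      γ 0 ∈ ball p (d / 4) ∧ γ T ∈ ball q (d / 4) ∧ dist (γ t) p = d / 2 ∧
      infDist (γ t) Ωᶜ ≤ 1 / ((m : ℝ) + 1) := by
    intro m
    have hm : 0 < 1 / ((m : ℝ) + 1) := by positivity
    obtain ⟨γ, T, hT, hγ, h0, h1, havoid⟩ :=
      hcon (closure Ω ∩ {x | 1 / ((m : ℝ) + 1) ≤ infDist x Ωᶜ})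
        (hb.isCompact_closure.inter_right (isClosed_le continuous_const (continuous_infDist_pt _)))
        (fun x hx => by
          by_contra hxΩ
          have : infDist x Ωᶜ = 0 := infDist_zero_of_mem hxΩ
          have h : 1 / ((m : ℝ) + 1) ≤ infDist x Ωᶜ := hx.2
          linarith)
    have hcont : ContinuousOn (fun t => dist (γ t) p) (Icc 0 T) :=
      (continuous_id.dist continuous_const).comp_continuousOn (hγ.continuousOn hO hne hc)
    have hivt := intermediate_value_Icc hT hcont
    rw [mem_ball] at h0 h1
    have h2 := dist_triangle_left p q (γ T)
    obtain ⟨t, ht, htd⟩ := hivt (show d / 2 ∈ Icc _ _ from ⟨by linarith, by linarith⟩)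
    refine ⟨γ, T, t, hγ, ht, h0, h1, htd, le_of_not_ge fun h => ?_⟩
    exact havoid t ht ⟨subset_closure (hγ.1 t ht), h⟩
  choose γ T t hγ ht hx hy hz hzΩ using hstep
  have hT : ∀ m, 0 ≤ T m := fun m => (ht m).1.trans (ht m).2
  have h0 : ∀ m, 0 ∈ Icc 0 (T m) := fun m => ⟨le_rfl, hT m⟩
  have h1 : ∀ m, T m ∈ Icc 0 (T m) := fun m => ⟨hT m, le_rfl⟩
  obtain ⟨⟨X, Y, Z⟩, -, φ, hφ, hlim⟩ := tendsto_subseq_of_bounded (hb.prod (hb.prod hb))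
    (x := fun m => (γ m 0, γ m (T m), γ m (t m)))
    fun m => ⟨(hγ m).1 _ (h0 m), (hγ m).1 _ (h1 m), (hγ m).1 _ (ht m)⟩
  have hlimX : Tendsto (fun m => γ (φ m) 0) atTop (𝓝 X) := hlim.fst_nhds
  have hlimY : Tendsto (fun m => γ (φ m) (T (φ m))) atTop (𝓝 Y) := hlim.snd_nhds.fst_nhds
  have hlimZ : Tendsto (fun m => γ (φ m) (t (φ m))) atTop (𝓝 Z) := hlim.snd_nhds.snd_nhds
  have hZ : Z ∈ Ωᶜ := by
    rw [hO.isClosed_compl.mem_iff_infDist_zero hne]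
    refine le_antisymm ?_ infDist_nonneg
    refine le_of_tendsto_of_tendsto' (((continuous_infDist_pt Ωᶜ).tendsto Z).comp hlimZ)
      (tendsto_one_div_add_atTop_nhds_zero_nat.comp hφ.tendsto_atTop) fun m => hzΩ (φ m)
  have hXZ : d / 4 ≤ dist X Z := ge_of_tendsto' (hlimX.dist hlimZ) fun m => by
    have := hx (φ m)
    rw [mem_ball] at this
    linarith [hz (φ m), dist_triangle_left (γ (φ m) (t (φ m))) p (γ (φ m) 0)]
  have hYZ : d / 4 ≤ dist Y Z := ge_of_tendsto' (hlimY.dist hlimZ) fun m => by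
    have := hy (φ m)
    rw [mem_ball] at this
    linarith [hz (φ m), dist_triangle (γ (φ m) (T (φ m))) (γ (φ m) (t (φ m))) p,
      dist_triangle_left p q (γ (φ m) (T (φ m)))]
  obtain ⟨M, hM, hcap⟩ := exists_capacity_const hO hne hc hG hn
  obtain ⟨A, hA, hcurve⟩ := hQC.exists_isPreconnected
  have hκ : 0 < d / (32 * A) := by positivity
  have hevX := hlimX.eventually (ball_mem_nhds X hκ)
  have hevY := hlimY.eventually (ball_mem_nhds Y hκ)
  have hκA : ∀ u, u < d / (32 * A) → A * u < d / 32 ∧ u < d / 32 := fun u hu => by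
    have h : d / (32 * A) ≤ d / 32 := by
      gcongr
      linarith
    refine ⟨?_, hu.trans_le h⟩
    rw [lt_div_iff₀ (by positivity)] at hu
    linarith
  have hfar : ∀ {W u v w : E}, d / 4 ≤ dist W Z → dist u W < d / (32 * A) →
      dist v W < d / (32 * A) → dist w u ≤ A * dist u v → d / 8 ≤ dist w Z := by
    intro W u v w hW hu hv hw
    obtain ⟨hu1, hu2⟩ := hκA _ hu
    obtain ⟨hv1, -⟩ := hκA _ hv
    have e1 := mul_le_mul_of_nonneg_left (dist_triangle_right u v W) (zero_le_one.trans hA)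
    have e2 := dist_triangle W u Z
    have e3 := dist_triangle u w Z
    rw [dist_comm] at hu2
    rw [dist_comm] at hw
    linarith
  obtain ⟨j, hjX, hjY⟩ := (hevX.and hevY).exists
  set l := φ j with hl
  have hΓcont := (hγ l).continuousOn hO hne hc
  set Γ := γ l '' Icc 0 (T l) with hΓ
  have hΓΩ : Γ ⊆ Ω := image_subset_iff.2 (hγ l).1
  have hΓcpt : IsCompact Γ := isCompact_Icc.image_of_continuousOn hΓcont
  have hΓne : Γ.Nonempty := ⟨_, mem_image_of_mem _ (h0 l)⟩
  have hZΓ : 0 < infDist Z Γ :=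
    (hΓcpt.isClosed.notMem_iff_infDist_pos hΓne).1 fun h => hZ (hΓΩ h)
  set R := min (d / 8) (infDist Z Γ) with hRdef
  have hR : 0 < R := lt_min (by positivity) hZΓ
  set r := R / (2 * M) with hrdef
  have hr : 0 < r := by positivity
  obtain ⟨i, ⟨hiX, hiY⟩, hiZ⟩ :=
    ((hevX.and hevY).and (hlimZ.eventually (ball_mem_nhds Z hr))).exists
  set m := φ i with hm
  have hxm := (hγ m).1 _ (h0 m)
  have hym := (hγ m).1 _ (h1 m)
  obtain ⟨C₁, hC₁Ω, hC₁, hC₁m, hC₁l, hC₁d⟩ := hcurve _ hxm _ ((hγ l).1 _ (h0 l))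
  obtain ⟨C₂, hC₂Ω, hC₂, hC₂m, hC₂l, hC₂d⟩ := hcurve _ hym _ ((hγ l).1 _ (h1 l))
  refine hcap Z hZ r R hr ?_ (γ m (t m)) ((hγ m).1 _ (ht m)) (γ m 0) hxm (γ m (T m)) hym ?_ ?_
    (C₁ ∪ Γ ∪ C₂) (union_subset (union_subset hC₁Ω hΓΩ) hC₂Ω) ?_ (Or.inl (Or.inl hC₁m))
    (Or.inr hC₂m) (Or.inl ⟨(mem_ball.1 hiZ).le, ?_⟩)
  · rw [hrdef]
    field_simp
    norm_num
  · intro h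
    have hd1 := hx m
    have hd2 := hy m
    rw [mem_ball] at hd1 hd2
    rw [← h] at hd2
    linarith [dist_triangle_left p q (γ m 0)]
  · rw [(hγ m).2 _ (h0 m) _ (ht m), (hγ m).2 _ (ht m) _ (h1 m), (hγ m).2 _ (h0 m) _ (h1 m),
      abs_of_nonpos (by linarith [(ht m).1]), abs_of_nonpos (by linarith [(ht m).2]),
      abs_of_nonpos (by linarith [hT m])]
    ring
  · refine IsPreconnected.union _ (Or.inr (mem_image_of_mem _ (h1 l))) hC₂l ?_ hC₂
    exact IsPreconnected.union _ hC₁l (mem_image_of_mem _ (h0 l)) hC₁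
      (isPreconnected_Icc.image _ hΓcont)
  · rintro w ((hw | hw) | hw)
    · exact (min_le_left _ _).trans (hfar hXZ hiX hjX (hC₁d w hw))
    · rw [dist_comm]
      exact (min_le_right _ _).trans (infDist_le_dist_of_mem hw)
    · exact (min_le_left _ _).trans (hfar hYZ hiY hjY (hC₂d w hw))

end Visibility

/-- If `Ω ⊆ ℝⁿ` is a bounded domain with `(Ω, k_Ω)` Gromov hyperbolic and
`(Ω, d_Euc)` quasi-convex, then `Ω` is a QH-visibility domain with no geodesic loop in the
Euclidean closure. -/
theorem statement3 {n : ℕ} (Ω : Set (EuclideanSpace ℝ (Fin n)))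
    (hOpen : IsOpen Ω) (hConn : IsConnected Ω) (hBdd : Bornology.IsBounded Ω)
    (hGromov : QHGromovHyperbolic Ω) (hQC : IsQuasiconvexSet Ω) :
    QHVisibilityDomain Ω ∧ NoGeodesicLoop Ω := by
  rcases Ωᶜ.eq_empty_or_nonempty with hempty | hne
  · obtain rfl := compl_empty_iff.1 hempty
    refine ⟨fun p hp => by simp at hp, fun γ hγ _ => ?_⟩
    have h := hγ.2 0 trivial 1 trivial
    have hsub : Subsingleton (EuclideanSpace ℝ (Fin n)) := by
      by_contra hsub
      rw [not_subsingleton_iff_nontrivial] at hsub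
      exact NormedSpace.unbounded_univ ℝ _ hBdd
    have hle : qhDist univ (γ 0) (γ 1) ≤ 0 := by
      have : qhAdmissible univ (γ 0) (γ 1) (fun _ => γ 0) 0 1 :=
        ⟨zero_le_one, rfl, Subsingleton.elim _ _, fun _ _ => trivial, 0,
          LipschitzWith.const' _ |>.lipschitzOnWith⟩
      simpa [qhLength] using qhDist_le_qhLength this
    rw [h] at hle
    norm_num at hle
  · obtain ⟨x, hx⟩ := hConn.nonempty
    obtain ⟨y, hy⟩ := hne
    have : Nontrivial (EuclideanSpace ℝ (Fin n)) := ⟨x, y, fun h => hy (h ▸ hx)⟩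
    have hn : 1 ≤ Module.finrank ℝ (EuclideanSpace ℝ (Fin n)) := Module.finrank_pos
    exact ⟨qhVisibilityDomain_of_isQuasiconvexSet hOpen ⟨y, hy⟩ hConn.isPreconnected hBdd hGromov
      hQC hn, noGeodesicLoop_of_isQuasiconvexSet hOpen ⟨y, hy⟩ hConn.isPreconnected hBdd hGromov
      hQC hn⟩

end
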